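/- arXiv:2309.11965 — 3 statements merged into one kernel-verified Lean document; each statement's English description precedes it below -/
import Mathlib

section
/- Assume K ⊆ L(G) is nonempty, prefix-closed, and conditionally decomposable (K = P1(K) ∥ P2(K)), and suppose each local observation map Φ_i^a is induced by the concrete sensor-attack model of the local plant automaton G_i (with every attack language nonempty) and is extended to L(G) by Φ_i^a(s) := Φ_i^a(P_i(s)). Then there exist local supervisors S1, S2 such that L_a((S1^a ∧ S2^a)/G) = K and L_a(S_i^a/G_i) ⊆ P_i(K) for i = 1,2 if and only if, for i = 1,2, P_i(K) is CA-controllable with respect to L(G_i), Σ_uc ∩ Σ_i, Σ_c^a ∩ Σ_i, and CA-observable with respect to L(G_i), Σ_o ∩ Σ_i, Φ_i^a. -/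
attribute [local instance] Classical.propDecidable

noncomputable section

namespace DESCA

variable {E Q R : Type*}

/-- Natural projection onto a sub-alphabet `A`: erase all events not in `A`. -/
def proj (A : Set E) : List E → List E
  | [] => []
  | a :: s => if a ∈ A then a :: proj A s else proj A s

/-- A language is prefix-closed if it contains every prefix of each of its members. -/
def PrefixClosed (L : Set (List E)) : Prop :=
  ∀ s t : List E, s <+: t → t ∈ L → s ∈ L

/-- Prefix closure of a language. -/
def prefixClosure (L : Set (List E)) : Set (List E) :=
  {s | ∃ t ∈ L, s <+: t}

/-- Strings over the sub-alphabet `A`. -/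
def Strings (A : Set E) : Set (List E) := {s | ∀ a ∈ s, a ∈ A}

/-- Synchronous product of `L1 ⊆ A1*` and `L2 ⊆ A2*`:
`L1 ∥ L2 = P1⁻¹(L1) ∩ P2⁻¹(L2)`. -/
def sync (A1 A2 : Set E) (L1 L2 : Set (List E)) : Set (List E) :=
  {s | proj A1 s ∈ L1 ∧ proj A2 s ∈ L2}

/-- Actuator-attack alteration of a control pattern `g`:
`Δ(g) = {(g \ g') ∪ g'' : g', g'' ⊆ Eca}`. -/
def Delta (Eca : Set E) (g : Set E) : Set (Set E) :=
  {ga | ∃ g' g'', g' ⊆ Eca ∧ g'' ⊆ Eca ∧ ga = (g \ g') ∪ g''}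

/-- Large language `L_a(S^a/G)` of a single supervised system over alphabet `A`:
`ε` belongs to it, and for `s` in it and `σ ∈ A`, `s ++ [σ]` belongs to it iff
`s ++ [σ] ∈ LG` and (`σ` uncontrollable, or enabled by some attacked control
`g ∈ Sa w` for some observation `w ∈ Phi s`). -/
inductive LargeLang (A : Set E) (LG : Set (List E)) (Euc : Set E)
    (Phi : List E → Set (List E)) (Sa : List E → Set (Set E)) : List E → Prop
  | nil : LargeLang A LG Euc Phi Sa []
  | step {s : List E} {σ : E} :
      LargeLang A LG Euc Phi Sa s → σ ∈ A → s ++ [σ] ∈ LG →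
      (σ ∈ Euc ∨ ∃ w ∈ Phi s, ∃ g ∈ Sa w, σ ∈ g) →
      LargeLang A LG Euc Phi Sa (s ++ [σ])

/-- Large language `L_a((S1^a ∧ S2^a)/G)` of the conjunctively supervised system:
`ε` belongs to it, and for `s` in it and `σ`, `s ++ [σ]` belongs to it iff
`s ++ [σ] ∈ LG` and (`σ` uncontrollable or
`∃ w1 ∈ Phi1 s, ∃ w2 ∈ Phi2 s, ∃ g1 ∈ Sa1 w1, ∃ g2 ∈ Sa2 w2,`
`σ ∈ (g1 ∪ (Σ \ A1)) ∩ (g2 ∪ (Σ \ A2))`). -/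
inductive ConjLargeLang (A1 A2 : Set E) (LG : Set (List E)) (Euc : Set E)
    (Phi1 Phi2 : List E → Set (List E)) (Sa1 Sa2 : List E → Set (Set E)) :
    List E → Prop
  | nil : ConjLargeLang A1 A2 LG Euc Phi1 Phi2 Sa1 Sa2 []
  | step {s : List E} {σ : E} :
      ConjLargeLang A1 A2 LG Euc Phi1 Phi2 Sa1 Sa2 s → s ++ [σ] ∈ LG →
      (σ ∈ Euc ∨ ∃ w1 ∈ Phi1 s, ∃ w2 ∈ Phi2 s, ∃ g1 ∈ Sa1 w1, ∃ g2 ∈ Sa2 w2,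
        σ ∈ (g1 ∪ A1ᶜ) ∩ (g2 ∪ A2ᶜ)) →
      ConjLargeLang A1 A2 LG Euc Phi1 Phi2 Sa1 Sa2 (s ++ [σ])

/-- Run of a deterministic automaton with partial transition function. -/
def dfaRun (δ : Q → E → Option Q) : Q → List E → Option Q
  | q, [] => some q
  | q, σ :: s => (δ q σ).bind fun q' => dfaRun δ q' s

/-- Language generated by a DFA with partial transition function:
strings whose run from `q0` is defined. -/
def dfaLang (δ : Q → E → Option Q) (q0 : Q) : Set (List E) :=
  {s | (dfaRun δ q0 s).isSome}

/-- Restriction of the transition function to a sub-automaton with state set `QH`. -/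
def restrictDelta (δ : Q → E → Option Q) (QH : Set Q) (q : Q) (σ : E) : Option Q :=
  match δ q σ with
  | none => none
  | some q' => if q ∈ QH ∧ q' ∈ QH then some q' else none

/-- Concrete sensor-attack map `Θ^a` along the run from state `q`:
`Θ^a(σ1⋯σn) = L1 L2 ⋯ Ln` where `Lk = {σk}` for a non-attacked transition and
`Lk = A_tr` (the attack language of the transition) for an attacked transition
(those labeled by events in `Eoa`). -/
def Theta (δ : Q → E → Option Q) (Eoa : Set E) (Att : Q → E → Set (List E)) :
    Q → List E → Set (List E)
  | _, [] => {([] : List E)}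
  | q, σ :: s =>
    match δ q σ with
    | none => ∅
    | some q' =>
      {w | ∃ u v, u ∈ (if σ ∈ Eoa then Att q σ else {[σ]}) ∧
            v ∈ Theta δ Eoa Att q' s ∧ w = u ++ v}

/-- Observation map `Φ^a(s) = P(Θ^a(s))` of the concrete sensor-attack model,
projecting onto the observable events `Eo`. -/
def PhiOf (δ : Q → E → Option Q) (q0 : Q) (Eo Eoa : Set E)
    (Att : Q → E → Set (List E)) (s : List E) : Set (List E) :=
  proj Eo '' Theta δ Eoa Att q0 s

/-- CA-controllability of `K` w.r.t. plant language `LG` and event set `A`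
(`A` playing the role of `Σ_uc ∪ Σ_c^a`, possibly intersected with a local alphabet). -/
def CACont (K LG : Set (List E)) (A : Set E) : Prop :=
  ∀ s σ, s ∈ K → σ ∈ A → s ++ [σ] ∈ LG → s ++ [σ] ∈ K

/-- CA-observability of `K` w.r.t. plant language `LG` and observation map `Phi`. -/
def CAObs (K LG : Set (List E)) (Phi : List E → Set (List E)) : Prop :=
  ∀ s σ, s ++ [σ] ∈ K →
    ∃ w ∈ Phi s, ∀ s' ∈ LG, w ∈ Phi s' → s' ∈ K →
      s' ++ [σ] ∈ LG → s' ++ [σ] ∈ K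

/-- State estimate after observing `w`:
`E_H^a(w) = {q ∈ QH : ∃ s ∈ L(H), w ∈ Φ^a(s) ∧ δ_H(q0, s) = q}`. -/
def estimate (δH : Q → E → Option Q) (q0 : Q) (QH : Set Q)
    (Phi : List E → Set (List E)) (w : List E) : Set Q :=
  {q | q ∈ QH ∧ ∃ s, dfaRun δH q0 s = some q ∧ w ∈ Phi s}

/-- Disablement set: events leading from some estimated state to an illegal state. -/
def rho (δ : Q → E → Option Q) (QH : Set Q) (x : Set Q) : Set E :=
  {σ | ∃ q ∈ x, ∃ q', δ q σ = some q' ∧ q' ∉ QH}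

/-- State-estimate-based CA-supervisor:
`S_CA(w) = (Ei \ ρ(E_H^a(w))) ∪ (Euc ∩ Ei)` if `w ∈ Φ^a(L(H))`, else `Euc ∩ Ei`. -/
def CASup (δ δH : Q → E → Option Q) (q0 : Q) (QH : Set Q)
    (Phi : List E → Set (List E)) (Ei Euc : Set E) (w : List E) : Set E :=
  if ∃ s ∈ dfaLang δH q0, w ∈ Phi s then
    (Ei \ rho δ QH (estimate δH q0 QH Phi w)) ∪ (Euc ∩ Ei)
  else Euc ∩ Ei

/-- A (nondeterministic) automaton with ε-moves: transitions are labeled by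
`some σ` (an event) or `none` (ε). -/
structure ENFA (E : Type*) (Q : Type*) where
  start : Q
  step : Q → Option E → Q → Prop
  accept : Set Q

/-- `N.Reaches q s q'`: there is a run of the ε-NFA `N` from `q` to `q'`
reading the string `s`, interleaving arbitrarily many ε-moves. -/
inductive ENFA.Reaches (N : ENFA E Q) : Q → List E → Q → Prop
  | refl (q : Q) : ENFA.Reaches N q [] q
  | eps {q q' q'' : Q} {s : List E} :
      N.step q none q' → ENFA.Reaches N q' s q'' → ENFA.Reaches N q s q''
  | symb {q q' q'' : Q} {σ : E} {s : List E} :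
      N.step q (some σ) q' → ENFA.Reaches N q' s q'' →
      ENFA.Reaches N q (σ :: s) q''

/-- Marked language of an ε-NFA. -/
def ENFA.markedLang (N : ENFA E Q) : Set (List E) :=
  {s | ∃ q ∈ N.accept, N.Reaches N.start s q}

/-- Generated language of an ε-NFA: strings having at least one run from the start. -/
def ENFA.genLang (N : ENFA E Q) : Set (List E) :=
  {s | ∃ q, N.Reaches N.start s q}

/-- Attack language `A_tr = L_m(F_tr)` marked by the attack automaton attached to
the transition leaving `q` on event `σ`. -/
def Atr (Finit : Q → E → R) (Fd : Q → E → R → E → Option R)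
    (Fm : Q → E → Set R) (q : Q) (σ : E) : Set (List E) :=
  {t | ∃ r, dfaRun (Fd q σ) (Finit q σ) t = some r ∧ r ∈ Fm q σ}

/-- Transition relation of the extended automaton `G^a`: non-attacked transitions
are kept; each attacked transition `(q, σ, q')` (i.e. `σ ∈ Eoa` and `δ q σ` defined)
is replaced by an ε-transition from `q` into the attack automaton `F_tr`, the
transitions of `F_tr`, and ε-transitions from marked states of `F_tr` to `q'`. -/
inductive GaStep (δ : Q → E → Option Q) (Eoa : Set E)
    (Finit : Q → E → R) (Fd : Q → E → R → E → Option R) (Fm : Q → E → Set R) :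
    Q ⊕ Q × E × R → Option E → Q ⊕ Q × E × R → Prop
  | keep {q : Q} {σ : E} {q' : Q} :
      δ q σ = some q' → σ ∉ Eoa →
      GaStep δ Eoa Finit Fd Fm (Sum.inl q) (some σ) (Sum.inl q')
  | enter {q : Q} {σ : E} :
      σ ∈ Eoa → (δ q σ).isSome →
      GaStep δ Eoa Finit Fd Fm (Sum.inl q) none (Sum.inr (q, σ, Finit q σ))
  | inner {q : Q} {σ : E} {r : R} {τ : E} {r' : R} :
      σ ∈ Eoa → (δ q σ).isSome → Fd q σ r τ = some r' →
      GaStep δ Eoa Finit Fd Fm (Sum.inr (q, σ, r)) (some τ) (Sum.inr (q, σ, r'))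
  | exit {q : Q} {σ : E} {q' : Q} {r : R} :
      δ q σ = some q' → σ ∈ Eoa → r ∈ Fm q σ →
      GaStep δ Eoa Finit Fd Fm (Sum.inr (q, σ, r)) none (Sum.inl q')

/-- The extended ε-NFA `G^a`, whose marked states are the plant states. -/
def Ga (δ : Q → E → Option Q) (q0 : Q) (Eoa : Set E)
    (Finit : Q → E → R) (Fd : Q → E → R → E → Option R) (Fm : Q → E → Set R) :
    ENFA E (Q ⊕ Q × E × R) where
  start := Sum.inl q0
  step := GaStep δ Eoa Finit Fd Fm
  accept := Set.range Sum.inl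

/-- Relabel every transition labeled by an event not in `Eo` as an ε-transition,
keeping all other transitions and the marked states. -/
def relabel (Eo : Set E) (N : ENFA E Q) : ENFA E Q where
  start := N.start
  step := fun q a q' =>
    (∃ σ ∈ Eo, a = some σ ∧ N.step q (some σ) q') ∨
    (a = none ∧ (N.step q none q' ∨ ∃ σ, σ ∉ Eo ∧ N.step q (some σ) q'))
  accept := N.accept

theorem proj_append (A : Set E) (s t : List E) : proj A (s ++ t) = proj A s ++ proj A t := by
  induction s with
  | nil => rfl
  | cons a s ih => by_cases h : a ∈ A <;> simp [proj, h, ih]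

theorem proj_append_singleton_of_mem {A : Set E} {σ : E} (h : σ ∈ A) (s : List E) :
    proj A (s ++ [σ]) = proj A s ++ [σ] := by
  simp [proj_append, proj, h]

theorem proj_append_singleton_of_notMem {A : Set E} {σ : E} (h : σ ∉ A) (s : List E) :
    proj A (s ++ [σ]) = proj A s := by
  simp [proj_append, proj, h]

theorem Theta_nonempty {δ : Q → E → Option Q} {Eoa : Set E} {Att : Q → E → Set (List E)}
    (hne : ∀ q σ, σ ∈ Eoa → (δ q σ).isSome → (Att q σ).Nonempty) (q : Q) (s : List E)
    (hs : (dfaRun δ q s).isSome) : (Theta δ Eoa Att q s).Nonempty := by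
  induction s generalizing q with
  | nil => exact ⟨[], rfl⟩
  | cons σ s ih =>
    cases hq : δ q σ with
    | none => simp [dfaRun, hq] at hs
    | some q' =>
      obtain ⟨v, hv⟩ := ih q' (by simpa [dfaRun, hq] using hs)
      have hu : (if σ ∈ Eoa then Att q σ else {[σ]}).Nonempty := by
        split_ifs with hσ
        · exact hne q σ hσ (by simp [hq])
        · exact Set.singleton_nonempty _
      obtain ⟨u, hu⟩ := hu
      simp only [Theta, hq]
      exact ⟨u ++ v, u, v, hu, hv, rfl⟩

theorem PhiOf_nonempty {δ : Q → E → Option Q} {q0 : Q} {Eoa : Set E}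
    {Att : Q → E → Set (List E)}
    (hne : ∀ q σ, σ ∈ Eoa → (δ q σ).isSome → (Att q σ).Nonempty) (Eo : Set E) {s : List E}
    (hs : s ∈ dfaLang δ q0) : (PhiOf δ q0 Eo Eoa Att s).Nonempty :=
  (Theta_nonempty hne q0 s hs).image _

theorem self_mem_Delta (Eca g : Set E) : g ∈ Delta Eca g :=
  ⟨∅, ∅, Set.empty_subset _, Set.empty_subset _, by simp⟩

theorem mem_or_mem_of_mem_Delta {Eca g g' : Set E} {σ : E} (hg : g' ∈ Delta Eca g)
    (hσ : σ ∈ g') : σ ∈ g ∨ σ ∈ Eca := by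
  obtain ⟨_, _, _, h, rfl⟩ := hg
  exact hσ.imp (fun h => h.1) (fun hσ => h hσ)

theorem exists_mem_Delta_of_mem {Eca : Set E} (g : Set E) {σ : E} (hσ : σ ∈ Eca) :
    ∃ g' ∈ Delta Eca g, σ ∈ g' :=
  ⟨g ∪ {σ}, ⟨∅, {σ}, Set.empty_subset _, by simpa using hσ, by simp⟩, by simp⟩

section Local

variable {A : Set E} {LG K' : Set (List E)} {Euc Eca : Set E} {Phi : List E → Set (List E)}

theorem LargeLang.of_append_singleton {Sa : List E → Set (Set E)} {s : List E} {σ : E}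
    (h : LargeLang A LG Euc Phi Sa (s ++ [σ])) :
    LargeLang A LG Euc Phi Sa s ∧ σ ∈ A ∧
      (σ ∈ Euc ∨ ∃ w ∈ Phi s, ∃ g ∈ Sa w, σ ∈ g) := by
  generalize ht : s ++ [σ] = t at h
  cases h with
  | nil => simp at ht
  | step hs hA _ hen =>
    obtain ⟨rfl, hσ⟩ := List.append_inj' ht rfl
    obtain rfl : σ = _ := by simpa using hσ
    exact ⟨hs, hA, hen⟩

theorem CACont_largeLang {S : List E → Set E}
    (hne : ∀ s, LargeLang A LG Euc Phi (fun w => Delta (Eca ∩ A) (S w)) s → (Phi s).Nonempty) :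
    CACont {s | LargeLang A LG Euc Phi (fun w => Delta (Eca ∩ A) (S w)) s} LG
      ((Euc ∪ Eca) ∩ A) := by
  rintro s σ hs ⟨hσ | hσ, hA⟩ hLG
  · exact LargeLang.step hs hA hLG (.inl hσ)
  · obtain ⟨w, hw⟩ := hne s hs
    exact LargeLang.step hs hA hLG (.inr ⟨w, hw, exists_mem_Delta_of_mem (S w) ⟨hσ, hA⟩⟩)

theorem CAObs_largeLang {Sa : List E → Set (Set E)}
    (hne : ∀ s, LargeLang A LG Euc Phi Sa s → (Phi s).Nonempty) :
    CAObs {s | LargeLang A LG Euc Phi Sa s} LG Phi := by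
  intro s σ hsσ
  obtain ⟨hs, hA, hσ | ⟨w, hw, hen⟩⟩ := LargeLang.of_append_singleton hsσ
  · obtain ⟨w, hw⟩ := hne s hs
    exact ⟨w, hw, fun s' _ _ hs' hLG => LargeLang.step hs' hA hLG (.inl hσ)⟩
  · exact ⟨w, hw, fun s' _ hw' hs' hLG =>
      LargeLang.step hs' hA hLG (.inr ⟨w, hw', hen⟩)⟩

/-- The most permissive supervisor that keeps every legal string compatible with the
observation inside `K'`. -/
def legalSup (A : Set E) (LG K' : Set (List E)) (Phi : List E → Set (List E)) (w : List E) :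
    Set E :=
  {σ | σ ∈ A ∧ ∀ s ∈ K', w ∈ Phi s → s ++ [σ] ∈ LG → s ++ [σ] ∈ K'}

theorem append_mem_of_enabled (hc : CACont K' LG ((Euc ∪ Eca) ∩ A)) {s : List E} {σ : E}
    (hs : s ∈ K') (hA : σ ∈ A) (hLG : s ++ [σ] ∈ LG)
    (hen : σ ∈ Euc ∨
      ∃ w ∈ Phi s, ∃ g ∈ Delta (Eca ∩ A) (legalSup A LG K' Phi w), σ ∈ g) :
    s ++ [σ] ∈ K' := by
  obtain hσ | ⟨w, hw, g, hg, hσ⟩ := hen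
  · exact hc s σ hs ⟨.inl hσ, hA⟩ hLG
  · obtain hσ | hσ := mem_or_mem_of_mem_Delta hg hσ
    · exact hσ.2 s hs hw hLG
    · exact hc s σ hs ⟨.inr hσ.1, hA⟩ hLG

theorem largeLang_legalSup_subset (hc : CACont K' LG ((Euc ∪ Eca) ∩ A)) (hnil : [] ∈ K') :
    {s | LargeLang A LG Euc Phi (fun w => Delta (Eca ∩ A) (legalSup A LG K' Phi w)) s} ⊆ K' := by
  intro s hs
  induction hs with
  | nil => exact hnil
  | step _ hA hLG hen ih => exact append_mem_of_enabled hc ih hA hLG hen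

theorem exists_mem_legalSup (hsub : K' ⊆ LG) (ho : CAObs K' LG Phi) {s : List E} {σ : E}
    (hA : σ ∈ A) (hs : s ++ [σ] ∈ K') : ∃ w ∈ Phi s, σ ∈ legalSup A LG K' Phi w := by
  obtain ⟨w, hw, h⟩ := ho s σ hs
  exact ⟨w, hw, hA, fun s' hs' hw' hLG => h s' (hsub hs') hw' hs' hLG⟩

/-- If the projection of `s` is legal, an event that is uncontrollable or not disabled by the
attacked local supervisor keeps the projection legal. -/
theorem proj_append_mem_of_enabled (hc : CACont K' LG ((Euc ∪ Eca) ∩ A)) {s : List E} {σ : E}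
    (hs : proj A s ∈ K') (hLG : proj A (s ++ [σ]) ∈ LG)
    (hen : σ ∈ Euc ∨ ∃ w ∈ Phi (proj A s),
      ∃ g ∈ Delta (Eca ∩ A) (legalSup A LG K' Phi w), σ ∈ g ∪ Aᶜ) :
    proj A (s ++ [σ]) ∈ K' := by
  by_cases hA : σ ∈ A
  · rw [proj_append_singleton_of_mem hA] at hLG ⊢
    refine append_mem_of_enabled (Phi := Phi) hc hs hA hLG (hen.imp_right ?_)
    rintro ⟨w, hw, g, hg, hσ⟩
    exact ⟨w, hw, g, hg, hσ.resolve_right (fun h => h hA)⟩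
  · rwa [proj_append_singleton_of_notMem hA]

theorem exists_enabled_of_proj_append_mem (hsub : K' ⊆ LG) (ho : CAObs K' LG Phi)
    {s : List E} {σ : E} (hne : (Phi (proj A s)).Nonempty) (hs : proj A (s ++ [σ]) ∈ K') :
    ∃ w ∈ Phi (proj A s),
      ∃ g ∈ Delta (Eca ∩ A) (legalSup A LG K' Phi w), σ ∈ g ∪ Aᶜ := by
  by_cases hA : σ ∈ A
  · rw [proj_append_singleton_of_mem hA] at hs
    obtain ⟨w, hw, hσ⟩ := exists_mem_legalSup hsub ho hA hs
    exact ⟨w, hw, _, self_mem_Delta _ _, .inl hσ⟩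
  · obtain ⟨w, hw⟩ := hne
    exact ⟨w, hw, _, self_mem_Delta _ _, .inr hA⟩

theorem LargeLang.proj_append {Sa : List E → Set (Set E)} {s : List E} {σ : E}
    (hs : LargeLang A LG Euc Phi Sa (proj A s)) (hLG : proj A (s ++ [σ]) ∈ LG)
    (hen : σ ∈ Euc ∨ ∃ w ∈ Phi (proj A s), ∃ g ∈ Sa w, σ ∈ g ∪ Aᶜ) :
    LargeLang A LG Euc Phi Sa (proj A (s ++ [σ])) := by
  by_cases hA : σ ∈ A
  · rw [proj_append_singleton_of_mem hA] at hLG ⊢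
    refine .step hs hA hLG (hen.imp_right ?_)
    rintro ⟨w, hw, g, hg, hσ⟩
    exact ⟨w, hw, g, hg, hσ.resolve_right (fun h => h hA)⟩
  · rwa [proj_append_singleton_of_notMem hA]

end Local

theorem ConjLargeLang.proj_largeLang {A1 A2 : Set E} {LG1 LG2 : Set (List E)} {Euc : Set E}
    {Phi1 Phi2 : List E → Set (List E)} {Sa1 Sa2 : List E → Set (Set E)} {s : List E}
    (h : ConjLargeLang A1 A2 (sync A1 A2 LG1 LG2) Euc (fun s => Phi1 (proj A1 s))
      (fun s => Phi2 (proj A2 s)) Sa1 Sa2 s) :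
    LargeLang A1 LG1 Euc Phi1 Sa1 (proj A1 s) ∧ LargeLang A2 LG2 Euc Phi2 Sa2 (proj A2 s) := by
  induction h with
  | nil => exact ⟨.nil, .nil⟩
  | step _ hLG hen ih =>
    refine ⟨ih.1.proj_append hLG.1 (hen.imp_right ?_),
      ih.2.proj_append hLG.2 (hen.imp_right ?_)⟩
    · rintro ⟨w1, hw1, _, _, g1, hg1, _, _, hσ⟩
      exact ⟨w1, hw1, g1, hg1, hσ.1⟩
    · rintro ⟨_, _, w2, hw2, _, _, g2, hg2, hσ⟩
      exact ⟨w2, hw2, g2, hg2, hσ.2⟩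

theorem conjLargeLang_legalSup_eq {A1 A2 : Set E} {LG1 LG2 K : Set (List E)} {Euc Eca : Set E}
    {Phi1 Phi2 : List E → Set (List E)} (hnil : [] ∈ K) (hKpc : PrefixClosed K)
    (hKsub : K ⊆ sync A1 A2 LG1 LG2) (hdec : K = sync A1 A2 (proj A1 '' K) (proj A2 '' K))
    (hne1 : ∀ s ∈ LG1, (Phi1 s).Nonempty) (hne2 : ∀ s ∈ LG2, (Phi2 s).Nonempty)
    (hc1 : CACont (proj A1 '' K) LG1 ((Euc ∪ Eca) ∩ A1)) (ho1 : CAObs (proj A1 '' K) LG1 Phi1)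
    (hc2 : CACont (proj A2 '' K) LG2 ((Euc ∪ Eca) ∩ A2)) (ho2 : CAObs (proj A2 '' K) LG2 Phi2) :
    {s | ConjLargeLang A1 A2 (sync A1 A2 LG1 LG2) Euc (fun s => Phi1 (proj A1 s))
      (fun s => Phi2 (proj A2 s))
      (fun w => Delta (Eca ∩ A1) (legalSup A1 LG1 (proj A1 '' K) Phi1 w))
      (fun w => Delta (Eca ∩ A2) (legalSup A2 LG2 (proj A2 '' K) Phi2 w)) s} = K := by
  apply Set.Subset.antisymm
  · intro s hs
    induction hs with
    | nil => exact hnil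
    | step _ hLG hen ih =>
      rw [hdec]
      refine ⟨proj_append_mem_of_enabled (Phi := Phi1) hc1 (Set.mem_image_of_mem _ ih)
          hLG.1 (hen.imp_right ?_),
        proj_append_mem_of_enabled (Phi := Phi2) hc2 (Set.mem_image_of_mem _ ih)
          hLG.2 (hen.imp_right ?_)⟩
      · rintro ⟨w1, hw1, _, _, g1, hg1, _, _, hσ⟩
        exact ⟨w1, hw1, g1, hg1, hσ.1⟩
      · rintro ⟨_, _, w2, hw2, _, _, g2, hg2, hσ⟩
        exact ⟨w2, hw2, g2, hg2, hσ.2⟩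
  · intro s
    induction s using List.reverseRecOn with
    | nil => exact fun _ => .nil
    | append_singleton s σ ih =>
      intro hsσ
      have hs : s ∈ K := hKpc _ _ (List.prefix_append s [σ]) hsσ
      obtain ⟨w1, hw1, g1, hg1, hσ1⟩ := exists_enabled_of_proj_append_mem (Eca := Eca)
        (Set.image_subset_iff.2 fun t ht => (hKsub ht).1) ho1 (hne1 _ (hKsub hs).1)
        (Set.mem_image_of_mem _ hsσ)
      obtain ⟨w2, hw2, g2, hg2, hσ2⟩ := exists_enabled_of_proj_append_mem (Eca := Eca)
        (Set.image_subset_iff.2 fun t ht => (hKsub ht).2) ho2 (hne2 _ (hKsub hs).2)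
        (Set.mem_image_of_mem _ hsσ)
      exact ConjLargeLang.step (ih hs) (hKsub hsσ)
        (.inr ⟨w1, hw1, w2, hw2, g1, hg1, g2, hg2, hσ1, hσ2⟩)

/-- Theorem 3 of the paper: for a nonempty prefix-closed conditionally
decomposable `K ⊆ L(G)`, with the concrete sensor-attack observation maps (nonempty
attack languages) extended to `L(G)` by `Φ_i^a(s) := Φ_i^a(P_i(s))`, there exist local
supervisors `S1, S2` with `L_a((S1^a ∧ S2^a)/G) = K` and `L_a(S_i^a/G_i) ⊆ P_i(K)` iff
each `P_i(K)` is CA-controllable and CA-observable for the local plant `G_i`. -/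
theorem exists_local_supervisors_iff_CACont_CAObs {E Q1 Q2 : Type*} [Fintype E]
    (E1 E2 Eo Ec Eca : Set E)
    (hcover : E1 ∪ E2 = Set.univ) (hca : Eca ⊆ Ec)
    (δ1 : Q1 → E → Option Q1) (q10 : Q1) (δ2 : Q2 → E → Option Q2) (q20 : Q2)
    (hδ1 : ∀ q σ q', δ1 q σ = some q' → σ ∈ E1)
    (hδ2 : ∀ q σ q', δ2 q σ = some q' → σ ∈ E2)
    (Eoa1 Eoa2 : Set E) (hoa1 : Eoa1 ⊆ E1 ∩ Eo) (hoa2 : Eoa2 ⊆ E2 ∩ Eo)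
    (Att1 : Q1 → E → Set (List E)) (Att2 : Q2 → E → Set (List E))
    (hAtt1str : ∀ q σ, Att1 q σ ⊆ Strings E1)
    (hAtt2str : ∀ q σ, Att2 q σ ⊆ Strings E2)
    (hAtt1ne : ∀ q σ, σ ∈ Eoa1 → (δ1 q σ).isSome → (Att1 q σ).Nonempty)
    (hAtt2ne : ∀ q σ, σ ∈ Eoa2 → (δ2 q σ).isSome → (Att2 q σ).Nonempty)
    (K : Set (List E)) (hKne : K.Nonempty) (hKpc : PrefixClosed K)
    (hKsub : K ⊆ sync E1 E2 (dfaLang δ1 q10) (dfaLang δ2 q20))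
    -- conditional decomposability
    (hdec : K = sync E1 E2 (proj E1 '' K) (proj E2 '' K)) :
    (∃ S1 S2 : List E → Set E,
        (∀ w, S1 w ⊆ E1) ∧ (∀ w, S2 w ⊆ E2) ∧
        {s | ConjLargeLang E1 E2
            (sync E1 E2 (dfaLang δ1 q10) (dfaLang δ2 q20)) Ecᶜ
            (fun s => PhiOf δ1 q10 (E1 ∩ Eo) Eoa1 Att1 (proj E1 s))
            (fun s => PhiOf δ2 q20 (E2 ∩ Eo) Eoa2 Att2 (proj E2 s))
            (fun w => Delta (Eca ∩ E1) (S1 w))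
            (fun w => Delta (Eca ∩ E2) (S2 w)) s} = K ∧
        {s | LargeLang E1 (dfaLang δ1 q10) Ecᶜ
            (PhiOf δ1 q10 (E1 ∩ Eo) Eoa1 Att1)
            (fun w => Delta (Eca ∩ E1) (S1 w)) s} ⊆ proj E1 '' K ∧
        {s | LargeLang E2 (dfaLang δ2 q20) Ecᶜ
            (PhiOf δ2 q20 (E2 ∩ Eo) Eoa2 Att2)
            (fun w => Delta (Eca ∩ E2) (S2 w)) s} ⊆ proj E2 '' K) ↔
      ((CACont (proj E1 '' K) (dfaLang δ1 q10) ((Ecᶜ ∪ Eca) ∩ E1) ∧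
          CAObs (proj E1 '' K) (dfaLang δ1 q10)
            (PhiOf δ1 q10 (E1 ∩ Eo) Eoa1 Att1)) ∧
        (CACont (proj E2 '' K) (dfaLang δ2 q20) ((Ecᶜ ∪ Eca) ∩ E2) ∧
          CAObs (proj E2 '' K) (dfaLang δ2 q20)
            (PhiOf δ2 q20 (E2 ∩ Eo) Eoa2 Att2))) := by
  have hne1 : ∀ s ∈ dfaLang δ1 q10, (PhiOf δ1 q10 (E1 ∩ Eo) Eoa1 Att1 s).Nonempty :=
    fun _ => PhiOf_nonempty hAtt1ne _
  have hne2 : ∀ s ∈ dfaLang δ2 q20, (PhiOf δ2 q20 (E2 ∩ Eo) Eoa2 Att2 s).Nonempty :=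
    fun _ => PhiOf_nonempty hAtt2ne _
  have hsub1 : proj E1 '' K ⊆ dfaLang δ1 q10 :=
    Set.image_subset_iff.2 fun t ht => (hKsub ht).1
  have hsub2 : proj E2 '' K ⊆ dfaLang δ2 q20 :=
    Set.image_subset_iff.2 fun t ht => (hKsub ht).2
  constructor
  · rintro ⟨S1, S2, -, -, hconj, hloc1, hloc2⟩
    have heq1 := hloc1.antisymm (Set.image_subset_iff.2 fun t ht =>
      (ConjLargeLang.proj_largeLang (hconj.superset ht)).1)
    have heq2 := hloc2.antisymm (Set.image_subset_iff.2 fun t ht =>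
      (ConjLargeLang.proj_largeLang (hconj.superset ht)).2)
    rw [← heq1, ← heq2]
    exact ⟨⟨CACont_largeLang fun s hs => hne1 s (hsub1 (hloc1 hs)),
        CAObs_largeLang fun s hs => hne1 s (hsub1 (hloc1 hs))⟩,
      ⟨CACont_largeLang fun s hs => hne2 s (hsub2 (hloc2 hs)),
        CAObs_largeLang fun s hs => hne2 s (hsub2 (hloc2 hs))⟩⟩
  · rintro ⟨⟨hc1, ho1⟩, hc2, ho2⟩
    have hnil : [] ∈ K := hKne.elim fun t ht => hKpc [] t List.nil_prefix ht
    exact ⟨_, _, fun w σ hσ => hσ.1, fun w σ hσ => hσ.1,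
      conjLargeLang_legalSup_eq hnil hKpc hKsub hdec hne1 hne2 hc1 ho1 hc2 ho2,
      largeLang_legalSup_subset hc1 ⟨[], hnil, rfl⟩,
      largeLang_legalSup_subset hc2 ⟨[], hnil, rfl⟩⟩

end DESCA

end
end

section
/- For every observation w ∈ Φ^a(L(H)), the state estimate equals the set of plant states reached by the ε-NFA H_ε^a on input w intersected with the legal states: E_H^a(w) = {q : q reachable from q0 in H_ε^a reading w (using ε-moves)} ∩ Q_H, i.e., E_H^a(w) = ξ(x_0, w) ∩ Q_H where ξ is the transition function of the subset-construction CA-observer of H_ε^a. -/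
attribute [local instance] Classical.propDecidable

noncomputable section

namespace DESCA

variable {E Q R : Type*}

theorem ENFA.Reaches.trans {N : ENFA E Q} {q q' q'' : Q} {s t : List E}
    (h : N.Reaches q s q') (h' : N.Reaches q' t q'') : N.Reaches q (s ++ t) q'' := by
  induction h with
  | refl => exact h'
  | eps hs _ ih => exact .eps hs (ih h')
  | symb hs _ ih => exact .symb hs (ih h')

/-- Relabeling unobservable events as `ε` projects the strings read along runs. -/
theorem reaches_relabel_iff {Eo : Set E} {N : ENFA E Q} {q q' : Q} {w : List E} :
    (relabel Eo N).Reaches q w q' ↔ ∃ t, proj Eo t = w ∧ N.Reaches q t q' := by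
  constructor
  · intro h
    induction h with
    | refl q => exact ⟨[], rfl, .refl q⟩
    | eps hs _ ih =>
      obtain ⟨t, rfl, ht⟩ := ih
      rcases hs with ⟨σ, _, h, _⟩ | ⟨_, hs | ⟨σ, hσ, hs⟩⟩
      · cases h
      · exact ⟨t, rfl, .eps hs ht⟩
      · exact ⟨σ :: t, by simp [proj, hσ], .symb hs ht⟩
    | symb hs _ ih =>
      obtain ⟨t, rfl, ht⟩ := ih
      rcases hs with ⟨σ, hσ, h, hs⟩ | ⟨h, _⟩
      · cases h
        exact ⟨_ :: t, by simp [proj, hσ], .symb hs ht⟩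
      · cases h
  · rintro ⟨t, rfl, h⟩
    induction h with
    | refl q => exact .refl q
    | eps hs _ ih => exact .eps (.inr ⟨rfl, .inl hs⟩) ih
    | @symb _ _ _ σ _ hs _ ih =>
      by_cases hσ : σ ∈ Eo
      · simp only [proj, hσ, if_true]
        exact .symb (.inl ⟨σ, hσ, rfl, hs⟩) ih
      · simp only [proj, hσ, if_false]
        exact .eps (.inr ⟨rfl, .inr ⟨σ, hσ, hs⟩⟩) ih

theorem mem_Theta_cons {δ : Q → E → Option Q} {Eoa : Set E} {Att : Q → E → Set (List E)}
    {q q' : Q} {σ : E} {s w : List E} (h : δ q σ = some q') :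
    w ∈ Theta δ Eoa Att q (σ :: s) ↔
      ∃ u v, u ∈ (if σ ∈ Eoa then Att q σ else {[σ]}) ∧
        v ∈ Theta δ Eoa Att q' s ∧ w = u ++ v := by
  simp only [Theta, h, Set.mem_ofPred_eq]

section ExtendedAutomaton

variable {δ : Q → E → Option Q} {q0 : Q} {Eoa : Set E} {Finit : Q → E → R}
  {Fd : Q → E → R → E → Option R} {Fm : Q → E → Set R}

theorem reaches_inr_of_dfaRun {q : Q} {σ : E} (hσ : σ ∈ Eoa) (hδ : (δ q σ).isSome)
    {u : List E} {r r' : R} (h : dfaRun (Fd q σ) r u = some r') :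
    (Ga δ q0 Eoa Finit Fd Fm).Reaches (Sum.inr (q, σ, r)) u (Sum.inr (q, σ, r')) := by
  induction u generalizing r with
  | nil =>
    cases h
    exact .refl _
  | cons τ u ih =>
    obtain ⟨r₁, h₁, h₂⟩ := Option.bind_eq_some_iff.mp h
    exact .symb (GaStep.inner hσ hδ h₁) (ih h₂)

theorem reaches_of_mem_Theta {q q' : Q} {s t : List E} (hs : dfaRun δ q s = some q')
    (ht : t ∈ Theta δ Eoa (Atr Finit Fd Fm) q s) :
    (Ga δ q0 Eoa Finit Fd Fm).Reaches (Sum.inl q) t (Sum.inl q') := by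
  induction s generalizing q t with
  | nil =>
    cases hs
    cases ht
    exact .refl _
  | cons σ s ih =>
    obtain ⟨q₁, h₁, h₂⟩ := Option.bind_eq_some_iff.mp hs
    obtain ⟨u, v, hu, hv, rfl⟩ := (mem_Theta_cons h₁).mp ht
    by_cases hσ : σ ∈ Eoa
    · rw [if_pos hσ] at hu
      obtain ⟨r, hr, hm⟩ := hu
      have hδ : (δ q σ).isSome := by simp [h₁]
      exact .eps (GaStep.enter hσ hδ) ((reaches_inr_of_dfaRun hσ hδ hr).trans
        (.eps (GaStep.exit h₁ hσ hm) (ih h₂ hv)))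
    · rw [if_neg hσ] at hu
      cases hu
      exact .symb (GaStep.keep h₁ hσ) (ih h₂ hv)

/-- Description of the strings `t` read along runs to the plant state `q'`, for a run starting
in a plant state or in a state of an attack automaton. -/
def ReadsTo (δ : Q → E → Option Q) (Eoa : Set E) (Finit : Q → E → R)
    (Fd : Q → E → R → E → Option R) (Fm : Q → E → Set R) (q' : Q) (t : List E) :
    Q ⊕ Q × E × R → Prop
  | Sum.inl q => ∃ s, dfaRun δ q s = some q' ∧ t ∈ Theta δ Eoa (Atr Finit Fd Fm) q s
  | Sum.inr (q, σ, r) => ∃ u v r' q₁ s, dfaRun (Fd q σ) r u = some r' ∧ r' ∈ Fm q σ ∧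
      δ q σ = some q₁ ∧ dfaRun δ q₁ s = some q' ∧
      v ∈ Theta δ Eoa (Atr Finit Fd Fm) q₁ s ∧ t = u ++ v

theorem readsTo_of_reaches {x y : Q ⊕ Q × E × R} {t : List E} {q' : Q}
    (h : (Ga δ q0 Eoa Finit Fd Fm).Reaches x t y) (hy : y = Sum.inl q') :
    ReadsTo δ Eoa Finit Fd Fm q' t x := by
  induction h with
  | refl =>
    subst hy
    exact ⟨[], rfl, rfl⟩
  | eps hs _ ih =>
    have ih := ih hy
    cases hs with
    | @enter q σ hσ _ =>
      obtain ⟨u, v, r', q₁, s, hr, hm, hδ, hq, hv, rfl⟩ := ih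
      exact ⟨σ :: s, by simp [dfaRun, hδ, hq],
        (mem_Theta_cons hδ).mpr ⟨u, v, by rw [if_pos hσ]; exact ⟨r', hr, hm⟩, hv, rfl⟩⟩
    | exit hδ _ hm =>
      obtain ⟨s, hq, ht⟩ := ih
      exact ⟨[], _, _, _, s, rfl, hm, hδ, hq, ht, rfl⟩
  | symb hs _ ih =>
    have ih := ih hy
    cases hs with
    | keep hδ hσ =>
      obtain ⟨s, hq, ht⟩ := ih
      exact ⟨_ :: s, by simp [dfaRun, hδ, hq],
        (mem_Theta_cons hδ).mpr ⟨[_], _, by rw [if_neg hσ]; rfl, ht, rfl⟩⟩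
    | inner _ _ hd =>
      obtain ⟨u, v, r', q₁, s, hr, hm, hδ, hq, hv, rfl⟩ := ih
      exact ⟨_ :: u, v, r', q₁, s, by simp [dfaRun, hd, hr], hm, hδ, hq, hv, rfl⟩

theorem reaches_inl_iff {q q' : Q} {t : List E} :
    (Ga δ q0 Eoa Finit Fd Fm).Reaches (Sum.inl q) t (Sum.inl q') ↔
      ∃ s, dfaRun δ q s = some q' ∧ t ∈ Theta δ Eoa (Atr Finit Fd Fm) q s :=
  ⟨fun h => readsTo_of_reaches h rfl, fun ⟨_, hs, ht⟩ => reaches_of_mem_Theta hs ht⟩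

end ExtendedAutomaton

/-- Theorem 4 of the paper, local version of state estimation:
for every observation `w ∈ Φ^a(L(H))`, the state estimate equals the set of plant
states reached by the ε-NFA `H_ε^a` on input `w` intersected with the legal states:
`E_H^a(w) = ξ(x0, w) ∩ Q_H`. -/
theorem state_estimate_eq_observer {E Q R : Type*} [Fintype E]
    (Eo Eoa : Set E) (hoa : Eoa ⊆ Eo)
    (δ : Q → E → Option Q) (q0 : Q) (QH : Set Q) (hq0 : q0 ∈ QH)
    (Finit : Q → E → R) (Fd : Q → E → R → E → Option R) (Fm : Q → E → Set R) :
    ∀ w, (∃ s ∈ dfaLang (restrictDelta δ QH) q0,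
          w ∈ PhiOf (restrictDelta δ QH) q0 Eo Eoa (Atr Finit Fd Fm) s) →
      {q | q ∈ QH ∧ ∃ s, dfaRun (restrictDelta δ QH) q0 s = some q ∧
            w ∈ PhiOf (restrictDelta δ QH) q0 Eo Eoa (Atr Finit Fd Fm) s}
        = {q | (relabel Eo (Ga (restrictDelta δ QH) q0 Eoa Finit Fd Fm)).Reaches
              (Sum.inl q0) w (Sum.inl q)} ∩ QH := by
  intro w _
  ext q
  simp only [Set.mem_inter_iff, Set.mem_ofPred_eq, reaches_relabel_iff, reaches_inl_iff, PhiOf,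
    Set.mem_image]
  constructor
  · rintro ⟨hq, s, hs, t, ht, hw⟩
    exact ⟨⟨t, hw, s, hs, ht⟩, hq⟩
  · rintro ⟨⟨t, hw, s, hs, ht⟩, hq⟩
    exact ⟨hq, s, hs, t, ht, hw⟩

end DESCA

end
end

section
/- Under Assumption 1 (Φ_i^a(P_i(s)) = Φ_i^a(s) for all s ∈ L(G), i = 1,2) and nonemptiness of the observation maps (Φ_i^a(s) ≠ ∅ for s ∈ L(G) ∪ L(G_i)), if the local supervisors satisfy L_a((S1^a ∧ S2^a)/G) = K, then P_i(K) ⊆ L_a(S_i^a/G_i) for i = 1,2; consequently, if in addition L_a(S_i^a/G_i) ⊆ P_i(K), then L_a(S_i^a/G_i) = P_i(K). -/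
attribute [local instance] Classical.propDecidable

noncomputable section

namespace DESCA

variable {E Q R : Type*}

theorem proj_singleton_of_mem {A : Set E} {σ : E} (h : σ ∈ A) : proj A [σ] = [σ] := by
  simp [proj, h]

theorem proj_singleton_of_notMem {A : Set E} {σ : E} (h : σ ∉ A) : proj A [σ] = [] := by
  simp [proj, h]

theorem PrefixClosed.sync {A1 A2 : Set E} {L1 L2 : Set (List E)}
    (h1 : PrefixClosed L1) (h2 : PrefixClosed L2) : PrefixClosed (sync A1 A2 L1 L2) := by
  rintro s _ ⟨r, rfl⟩ ⟨hs1, hs2⟩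
  rw [proj_append] at hs1 hs2
  exact ⟨h1 _ _ (List.prefix_append _ _) hs1, h2 _ _ (List.prefix_append _ _) hs2⟩

theorem ConjLargeLang.symm {A1 A2 : Set E} {LG : Set (List E)} {Euc : Set E}
    {Phi1 Phi2 : List E → Set (List E)} {Sa1 Sa2 : List E → Set (Set E)} {s : List E}
    (h : ConjLargeLang A1 A2 LG Euc Phi1 Phi2 Sa1 Sa2 s) :
    ConjLargeLang A2 A1 LG Euc Phi2 Phi1 Sa2 Sa1 s := by
  induction h with
  | nil => exact .nil
  | step _ hLG hσ ih =>
    refine .step ih hLG (hσ.imp_right ?_)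
    rintro ⟨w1, hw1, w2, hw2, g1, hg1, g2, hg2, h1, h2⟩
    exact ⟨w2, hw2, w1, hw1, g2, hg2, g1, hg1, h2, h1⟩

/-- The projection of a conjunctively supervised string is accepted by the local
supervised system, provided the local observation map factors through the projection. -/
theorem ConjLargeLang.largeLang_proj {A1 A2 : Set E} {LG LG1 : Set (List E)} {Euc : Set E}
    {Phi1 Phi2 : List E → Set (List E)} {Sa1 Sa2 : List E → Set (Set E)}
    (hpc : PrefixClosed LG) (hLG1 : ∀ s ∈ LG, proj A1 s ∈ LG1)
    (hPhi : ∀ s ∈ LG, Phi1 (proj A1 s) = Phi1 s) {s : List E}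
    (h : ConjLargeLang A1 A2 LG Euc Phi1 Phi2 Sa1 Sa2 s) :
    LargeLang A1 LG1 Euc Phi1 Sa1 (proj A1 s) := by
  induction h with
  | nil => exact .nil
  | @step s σ _ hLG hσ ih =>
    have hmem := hLG1 _ hLG
    rw [proj_append] at hmem ⊢
    by_cases hA : σ ∈ A1
    · rw [proj_singleton_of_mem hA] at hmem ⊢
      refine .step ih hA hmem (hσ.imp_right ?_)
      rintro ⟨w, hw, -, -, g, hg, -, -, hσg, -⟩
      rw [hPhi s (hpc _ _ (List.prefix_append _ _) hLG)]
      exact ⟨w, hw, g, hg, hσg.resolve_right (not_not_intro hA)⟩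
    · rwa [proj_singleton_of_notMem hA, List.append_nil]

/-- ONLY IF direction of Theorem 3: under Assumption 1 and nonemptiness
of the observation maps, if `L_a((S1^a ∧ S2^a)/G) = K` then
`P_i(K) ⊆ L_a(S_i^a/G_i)`; consequently, if in addition
`L_a(S_i^a/G_i) ⊆ P_i(K)`, then `L_a(S_i^a/G_i) = P_i(K)`. -/
theorem proj_K_subset_local_of_conj_eq {E : Type*} [Fintype E]
    (E1 E2 Eo Ec Eca : Set E)
    (hcover : E1 ∪ E2 = Set.univ) (hca : Eca ⊆ Ec)
    (LG1 LG2 : Set (List E))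
    (hLG1pc : PrefixClosed LG1) (hLG2pc : PrefixClosed LG2)
    (hLG1str : LG1 ⊆ Strings E1) (hLG2str : LG2 ⊆ Strings E2)
    (Phi1 Phi2 : List E → Set (List E))
    (hA1 : ∀ s ∈ sync E1 E2 LG1 LG2, Phi1 (proj E1 s) = Phi1 s)
    (hA2 : ∀ s ∈ sync E1 E2 LG1 LG2, Phi2 (proj E2 s) = Phi2 s)
    (hne1 : ∀ s ∈ sync E1 E2 LG1 LG2 ∪ LG1, (Phi1 s).Nonempty)
    (hne2 : ∀ s ∈ sync E1 E2 LG1 LG2 ∪ LG2, (Phi2 s).Nonempty)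
    (S1 S2 : List E → Set E)
    (hS1 : ∀ w, S1 w ⊆ E1) (hS2 : ∀ w, S2 w ⊆ E2)
    (K : Set (List E))
    (hconj : {s | ConjLargeLang E1 E2 (sync E1 E2 LG1 LG2) Ecᶜ Phi1 Phi2
        (fun w => Delta (Eca ∩ E1) (S1 w))
        (fun w => Delta (Eca ∩ E2) (S2 w)) s} = K) :
    (proj E1 '' K ⊆
        {s | LargeLang E1 LG1 Ecᶜ Phi1 (fun w => Delta (Eca ∩ E1) (S1 w)) s}) ∧
    (proj E2 '' K ⊆
        {s | LargeLang E2 LG2 Ecᶜ Phi2 (fun w => Delta (Eca ∩ E2) (S2 w)) s}) ∧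
    ({s | LargeLang E1 LG1 Ecᶜ Phi1 (fun w => Delta (Eca ∩ E1) (S1 w)) s}
        ⊆ proj E1 '' K →
      {s | LargeLang E1 LG1 Ecᶜ Phi1 (fun w => Delta (Eca ∩ E1) (S1 w)) s}
        = proj E1 '' K) ∧
    ({s | LargeLang E2 LG2 Ecᶜ Phi2 (fun w => Delta (Eca ∩ E2) (S2 w)) s}
        ⊆ proj E2 '' K →
      {s | LargeLang E2 LG2 Ecᶜ Phi2 (fun w => Delta (Eca ∩ E2) (S2 w)) s}
        = proj E2 '' K) := by
  subst hconj
  have hpc := hLG1pc.sync (A1 := E1) (A2 := E2) hLG2pc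
  have h1 : proj E1 '' {s | ConjLargeLang E1 E2 (sync E1 E2 LG1 LG2) Ecᶜ Phi1 Phi2
        (fun w => Delta (Eca ∩ E1) (S1 w)) (fun w => Delta (Eca ∩ E2) (S2 w)) s} ⊆
      {s | LargeLang E1 LG1 Ecᶜ Phi1 (fun w => Delta (Eca ∩ E1) (S1 w)) s} := by
    rintro _ ⟨s, hs, rfl⟩
    exact ConjLargeLang.largeLang_proj hpc (fun _ h => h.1) hA1 hs
  have h2 : proj E2 '' {s | ConjLargeLang E1 E2 (sync E1 E2 LG1 LG2) Ecᶜ Phi1 Phi2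
        (fun w => Delta (Eca ∩ E1) (S1 w)) (fun w => Delta (Eca ∩ E2) (S2 w)) s} ⊆
      {s | LargeLang E2 LG2 Ecᶜ Phi2 (fun w => Delta (Eca ∩ E2) (S2 w)) s} := by
    rintro _ ⟨s, hs, rfl⟩
    exact ConjLargeLang.largeLang_proj hpc (fun _ h => h.2) hA2 (ConjLargeLang.symm hs)
  exact ⟨h1, h2, fun h => h.antisymm h1, fun h => h.antisymm h2⟩

end DESCA

end
end
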